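/- arXiv:math/0305394 — 3 statements merged into one kernel-verified Lean document; each statement's English description precedes it below -/
import Mathlib

section
/- A polynomial h ∈ ℂ[q₁,…,qₙ,p₁,…,pₙ] satisfies {qᵢpᵢ, h} ∈ I for every i = 1,…,n if and only if there exists a constant c ∈ ℂ with h − c ∈ I. (This computes H⁰ of the Lagrange complex of the Lagrangian variety L = {q₁p₁ = ⋯ = qₙpₙ = 0}: the degree-zero cocycles are exactly the constants modulo I.) -/
open MvPolynomial

/-- The standard Poisson bracket on ℂ[q₁,…,qₙ,p₁,…,pₙ], where the variable
`Sum.inl i` is `qᵢ` and `Sum.inr i` is `pᵢ`. -/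
noncomputable def poissonBracket (n : ℕ)
    (f g : MvPolynomial (Fin n ⊕ Fin n) ℂ) : MvPolynomial (Fin n ⊕ Fin n) ℂ :=
  ∑ i : Fin n,
    (pderiv (Sum.inl i) f * pderiv (Sum.inr i) g -
      pderiv (Sum.inr i) f * pderiv (Sum.inl i) g)

theorem MvPolynomial.coeff_X_mul_pderiv {σ R : Type*} [CommSemiring R] (i : σ)
    (f : MvPolynomial σ R) (m : σ →₀ ℕ) :
    coeff m (X i * pderiv i f) = m i * coeff m f := by
  classical
  induction f using MvPolynomial.induction_on' with
  | monomial s a =>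
    rw [X_mul_pderiv_monomial, coeff_smul, coeff_monomial, nsmul_eq_mul]
    split_ifs with hs
    · rw [hs]
    · simp
  | add p q hp hq => rw [map_add, mul_add, coeff_add, hp, hq, coeff_add, mul_add]

theorem poissonBracket_X_mul_X {n : ℕ} (i : Fin n) (h : MvPolynomial (Fin n ⊕ Fin n) ℂ) :
    poissonBracket n (X (Sum.inl i) * X (Sum.inr i)) h =
      X (Sum.inr i) * pderiv (Sum.inr i) h - X (Sum.inl i) * pderiv (Sum.inl i) h := by
  classical
  unfold poissonBracket
  rw [Finset.sum_eq_single i]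
  · simp
  · intro j _ hj
    simp [hj.symm]
  · simp

theorem coeff_poissonBracket_X_mul_X {n : ℕ} (i : Fin n) (h : MvPolynomial (Fin n ⊕ Fin n) ℂ)
    (m : Fin n ⊕ Fin n →₀ ℕ) :
    coeff m (poissonBracket n (X (Sum.inl i) * X (Sum.inr i)) h) =
      ((m (Sum.inr i) : ℂ) - m (Sum.inl i)) * coeff m h := by
  rw [poissonBracket_X_mul_X, coeff_sub, coeff_X_mul_pderiv, coeff_X_mul_pderiv, sub_mul]

theorem mem_span_range_X_mul_X_iff {ι R : Type*} [CommSemiring R] (f : MvPolynomial (ι ⊕ ι) R) :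
    f ∈ Ideal.span (Set.range fun i : ι => (X (Sum.inl i) * X (Sum.inr i) :
        MvPolynomial (ι ⊕ ι) R)) ↔
      ∀ m, coeff m f ≠ 0 → ∃ i, m (Sum.inl i) ≠ 0 ∧ m (Sum.inr i) ≠ 0 := by
  classical
  have hrange : (Set.range fun i : ι => (X (Sum.inl i) * X (Sum.inr i) :
      MvPolynomial (ι ⊕ ι) R)) = (fun s => monomial s (1 : R)) ''
        Set.range fun i : ι => Finsupp.single (Sum.inl i) 1 + Finsupp.single (Sum.inr i) 1 := by
    rw [← Set.range_comp]
    congr 1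
    funext i
    simp [X, monomial_mul]
  rw [hrange, mem_ideal_span_monomial_image]
  simp only [mem_support_iff, Set.exists_range_iff]
  refine forall₂_congr fun m _ => exists_congr fun i => ⟨fun hle => ⟨?_, ?_⟩, ?_⟩
  · have := hle (Sum.inl i)
    simp at this
    omega
  · have := hle (Sum.inr i)
    simp at this
    omega
  · rintro ⟨hl, hr⟩ (j | j) <;> by_cases hj : i = j <;>
      simp_all [Nat.one_le_iff_ne_zero]

/-- `H⁰` of the Lagrange complex of `L = {q₁p₁ = ⋯ = qₙpₙ = 0}`: a polynomial
`h` satisfies `{qᵢpᵢ, h} ∈ I` for every `i` if and only if `h` is a constant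
modulo `I = (q₁p₁,…,qₙpₙ)`. -/
theorem stmt_4 (n : ℕ) (hn : 1 ≤ n)
    (I : Ideal (MvPolynomial (Fin n ⊕ Fin n) ℂ))
    (hI : I = Ideal.span
      (Set.range fun i : Fin n => (X (Sum.inl i) * X (Sum.inr i) :
        MvPolynomial (Fin n ⊕ Fin n) ℂ)))
    (h : MvPolynomial (Fin n ⊕ Fin n) ℂ) :
    (∀ i : Fin n, poissonBracket n (X (Sum.inl i) * X (Sum.inr i)) h ∈ I) ↔
      ∃ c : ℂ, h - C c ∈ I := by
  classical
  subst hI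
  simp only [mem_span_range_X_mul_X_iff, coeff_poissonBracket_X_mul_X, coeff_sub, coeff_C]
  constructor
  · intro H
    refine ⟨coeff 0 h, fun m hm => ?_⟩
    have hm0 : m ≠ 0 := by
      rintro rfl
      simp at hm
    rw [if_neg hm0.symm, sub_zero] at hm
    by_contra! hdisj
    obtain ⟨k, hk⟩ : ∃ k, m (Sum.inr k) ≠ m (Sum.inl k) := by
      by_contra! heq
      refine hm0 (Finsupp.ext ?_)
      rintro (k | k) <;> have := hdisj k <;> have := heq k <;> simp <;> omega
    obtain ⟨j, hl, hr⟩ := H k m (mul_ne_zero (sub_ne_zero.2 (Nat.cast_injective.ne hk)) hm)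
    exact hr (hdisj j hl)
  · rintro ⟨c, hc⟩ i m hm
    have hm0 : m ≠ 0 := by
      rintro rfl
      simp at hm
    refine hc m ?_
    rw [if_neg hm0.symm, sub_zero]
    exact right_ne_zero_of_mul hm
end

section
/- Let g₁,…,gₙ ∈ ℂ[q₁,…,qₙ,p₁,…,pₙ] satisfy the cocycle condition {qᵢpᵢ, gⱼ} − {qⱼpⱼ, gᵢ} ∈ I for all i, j. Then there exist constants c₁,…,cₙ ∈ ℂ and a polynomial h such that gᵢ − cᵢ − {qᵢpᵢ, h} ∈ I for every i; moreover the constants cᵢ are uniquely determined by (g₁,…,gₙ). (This is the computation in the example of Section 2.2: the first cohomology of the Lagrange complex of L = {q₁p₁ = ⋯ = qₙpₙ = 0} is generated by the classes [(1,0,…,0)], …, [(0,…,0,1)], so the absolute Kodaira–Spencer map of the deformation Fᵢ = qᵢpᵢ + λᵢ is surjective.) -/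
open MvPolynomial

namespace LagrangeComplex

/-- The weight of the monomial with exponent `m` under the Hamiltonian flow of `qᵢpᵢ`. -/
def weight {n : ℕ} (i : Fin n) (m : Fin n ⊕ Fin n →₀ ℕ) : ℂ :=
  (m (Sum.inr i) : ℂ) - m (Sum.inl i)

/-- The exponents of the monomials lying outside the ideal generated by the `qᵢpᵢ`. -/
def IsNormal {n : ℕ} (m : Fin n ⊕ Fin n →₀ ℕ) : Prop :=
  ∀ i, m (Sum.inl i) = 0 ∨ m (Sum.inr i) = 0

lemma isNormal_zero {n : ℕ} : IsNormal (0 : Fin n ⊕ Fin n →₀ ℕ) := fun _ => Or.inl rfl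

lemma IsNormal.exists_weight_ne_zero {n : ℕ} {m : Fin n ⊕ Fin n →₀ ℕ} (hm : IsNormal m)
    (h0 : m ≠ 0) : ∃ i, weight i m ≠ 0 := by
  contrapose! h0
  have key (i : Fin n) : m (Sum.inl i) = 0 ∧ m (Sum.inr i) = 0 := by
    have h : m (Sum.inr i) = m (Sum.inl i) := by exact_mod_cast sub_eq_zero.mp (h0 i)
    have := hm i
    omega
  ext (i | i)
  · exact (key i).1
  · exact (key i).2

lemma coeff_X_mul_pderiv {σ R : Type*} [CommSemiring R] (s : σ) (f : MvPolynomial σ R)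
    (m : σ →₀ ℕ) : coeff m (X s * pderiv s f) = m s * coeff m f := by
  classical
  induction f using MvPolynomial.induction_on' with
  | monomial u a =>
    rw [X_mul_pderiv_monomial, coeff_smul, coeff_monomial, nsmul_eq_mul]
    split_ifs with h
    · rw [h]
    · simp
  | add f g hf hg => simp only [map_add, mul_add, coeff_add, hf, hg]

lemma poissonBracket_X_mul_X {n : ℕ} (i : Fin n) (f : MvPolynomial (Fin n ⊕ Fin n) ℂ) :
    poissonBracket n (X (Sum.inl i) * X (Sum.inr i)) f =
      X (Sum.inr i) * pderiv (Sum.inr i) f - X (Sum.inl i) * pderiv (Sum.inl i) f := by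
  rw [poissonBracket, Finset.sum_eq_single_of_mem i (Finset.mem_univ i)]
  · simp [Derivation.leibniz, pderiv_X]
  · intro j _ hj
    simp [Derivation.leibniz, pderiv_X, hj.symm]

lemma coeff_poissonBracket {n : ℕ} (i : Fin n) (f : MvPolynomial (Fin n ⊕ Fin n) ℂ)
    (m : Fin n ⊕ Fin n →₀ ℕ) :
    coeff m (poissonBracket n (X (Sum.inl i) * X (Sum.inr i)) f) = weight i m * coeff m f := by
  rw [poissonBracket_X_mul_X, coeff_sub, coeff_X_mul_pderiv, coeff_X_mul_pderiv, weight, sub_mul]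

lemma mem_span_iff {n : ℕ} (f : MvPolynomial (Fin n ⊕ Fin n) ℂ) :
    f ∈ Ideal.span (Set.range fun i : Fin n => (X (Sum.inl i) * X (Sum.inr i) :
      MvPolynomial (Fin n ⊕ Fin n) ℂ)) ↔ ∀ m, IsNormal m → coeff m f = 0 := by
  have hrange : (Set.range fun i : Fin n => (X (Sum.inl i) * X (Sum.inr i) :
      MvPolynomial (Fin n ⊕ Fin n) ℂ)) = (fun s => monomial s (1 : ℂ)) ''
        Set.range fun i : Fin n => Finsupp.single (Sum.inl i) 1 + Finsupp.single (Sum.inr i) 1 := by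
    rw [← Set.range_comp]
    congr 1
    ext1 i
    simp [X, monomial_mul]
  have hle (i : Fin n) (m : Fin n ⊕ Fin n →₀ ℕ) :
      Finsupp.single (Sum.inl i) 1 + Finsupp.single (Sum.inr i) 1 ≤ m ↔
        m (Sum.inl i) ≠ 0 ∧ m (Sum.inr i) ≠ 0 := by
    constructor
    · intro h
      have hl := h (Sum.inl i)
      have hr := h (Sum.inr i)
      simp at hl hr
      omega
    · rintro ⟨hl, hr⟩ (j | j)
      · rcases eq_or_ne i j with rfl | hij
        · simpa [Nat.one_le_iff_ne_zero] using hl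
        · simp [hij]
      · rcases eq_or_ne i j with rfl | hij
        · simpa [Nat.one_le_iff_ne_zero] using hr
        · simp [hij]
  rw [hrange, mem_ideal_span_monomial_image]
  refine forall_congr' fun m => ?_
  simp only [Set.exists_range_iff, hle, mem_support_iff, IsNormal]
  rw [not_imp_comm]
  push Not
  simp only [imp_iff_not_or, not_not, ne_eq]

/-- A common primitive of a cocycle away from the weight-zero monomials. -/
lemma exists_primitive {n : ℕ} (g : Fin n → MvPolynomial (Fin n ⊕ Fin n) ℂ) :
    ∃ h : MvPolynomial (Fin n ⊕ Fin n) ℂ, ∀ m,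
      (∀ i j, weight i m * coeff m (g j) = weight j m * coeff m (g i)) →
      (∃ k, weight k m ≠ 0) → ∀ i, weight i m * coeff m h = coeff m (g i) := by
  classical
  have hφ (m : Fin n ⊕ Fin n →₀ ℕ) : ∃ a : ℂ,
      ((∀ i j, weight i m * coeff m (g j) = weight j m * coeff m (g i)) →
        (∃ k, weight k m ≠ 0) → ∀ i, weight i m * a = coeff m (g i)) := by
    by_cases hk : ∃ k, weight k m ≠ 0
    · obtain ⟨k, hk⟩ := hk
      refine ⟨coeff m (g k) / weight k m, fun hc _ i => ?_⟩
      rw [← mul_div_assoc, hc i k, mul_div_cancel_left₀ _ hk]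
    · exact ⟨0, fun _ h => absurd h hk⟩
  choose φ hφ using hφ
  refine ⟨∑ m ∈ Finset.univ.biUnion fun i => (g i).support, monomial m (φ m), fun m hc hk i => ?_⟩
  simp only [coeff_sum, coeff_monomial, Finset.sum_ite_eq']
  split_ifs with hm
  · exact hφ m hc hk i
  · simp only [Finset.mem_biUnion, Finset.mem_univ, true_and, not_exists,
      notMem_support_iff] at hm
    rw [mul_zero, hm i]

end LagrangeComplex

/-- `H¹` of the Lagrange complex of `L = {q₁p₁ = ⋯ = qₙpₙ = 0}` is generated
by the classes `[(1,0,…,0)], …, [(0,…,0,1)]`: every cocycle `(g₁,…,gₙ)` is,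
modulo `I` and modulo a coboundary `({qᵢpᵢ,h})ᵢ`, a uniquely determined tuple
of constants `(c₁,…,cₙ)`. -/
theorem stmt_5 (n : ℕ) (hn : 1 ≤ n)
    (I : Ideal (MvPolynomial (Fin n ⊕ Fin n) ℂ))
    (hI : I = Ideal.span
      (Set.range fun i : Fin n => (X (Sum.inl i) * X (Sum.inr i) :
        MvPolynomial (Fin n ⊕ Fin n) ℂ)))
    (g : Fin n → MvPolynomial (Fin n ⊕ Fin n) ℂ)
    (hcoc : ∀ i j : Fin n,
      poissonBracket n (X (Sum.inl i) * X (Sum.inr i)) (g j)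
        - poissonBracket n (X (Sum.inl j) * X (Sum.inr j)) (g i) ∈ I) :
    ∃! c : Fin n → ℂ, ∃ h : MvPolynomial (Fin n ⊕ Fin n) ℂ,
      ∀ i : Fin n,
        g i - C (c i) - poissonBracket n (X (Sum.inl i) * X (Sum.inr i)) h ∈ I := by
  subst hI
  simp only [LagrangeComplex.mem_span_iff, coeff_sub, LagrangeComplex.coeff_poissonBracket,
    sub_eq_zero] at hcoc ⊢
  have hw (i : Fin n) : LagrangeComplex.weight i 0 = 0 := by simp [LagrangeComplex.weight]
  refine ⟨fun i => coeff 0 (g i), ?_, fun c ⟨h, hc⟩ => funext fun i => ?_⟩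
  · obtain ⟨h, hh⟩ := LagrangeComplex.exists_primitive g
    refine ⟨h, fun i m hm => ?_⟩
    by_cases h0 : m = 0
    · subst h0
      simp [hw]
    · rw [hh m (fun i j => hcoc i j m hm) (hm.exists_weight_ne_zero h0), coeff_C,
        if_neg (Ne.symm h0), sub_zero]
  · have := hc i 0 LagrangeComplex.isNormal_zero
    rw [hw, zero_mul, coeff_zero_C, sub_eq_zero] at this
    exact this.symm
end

section
/- Let g₁,…,gₙ ∈ ℂ[λ₁,…,λₙ,q₁,…,qₙ,p₁,…,pₙ] satisfy the relative cocycle condition {Fᵢ, gⱼ} − {Fⱼ, gᵢ} ∈ J for all i, j, where Fᵢ = qᵢpᵢ + λᵢ and J = (F₁,…,Fₙ). Then there exist polynomials b₁,…,bₙ ∈ ℂ[λ₁,…,λₙ] and h ∈ ℂ[λ,q,p] such that gᵢ − bᵢ − {Fᵢ, h} ∈ J for every i; moreover the bᵢ are uniquely determined by (g₁,…,gₙ). (This instantiates, for the example of Section 2.2, the freeness statement of Theorem 1.8: the first cohomology of the relative Lagrange complex is a free module of rank n over the parameter ring, generated by the relative Kodaira–Spencer images of ∂/∂λ₁,…,∂/∂λₙ.)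 -/
open MvPolynomial

/-- The relative Poisson bracket on ℂ[λ₁,…,λₙ,q₁,…,qₙ,p₁,…,pₙ], taken in the
variables `(q,p)` only: the variable `Sum.inl i` is the parameter `λᵢ`,
`Sum.inr (Sum.inl i)` is `qᵢ` and `Sum.inr (Sum.inr i)` is `pᵢ`. -/
noncomputable def relPoissonBracket (n : ℕ)
    (f g : MvPolynomial (Fin n ⊕ (Fin n ⊕ Fin n)) ℂ) :
    MvPolynomial (Fin n ⊕ (Fin n ⊕ Fin n)) ℂ :=
  ∑ i : Fin n,
    (pderiv (Sum.inr (Sum.inl i)) f * pderiv (Sum.inr (Sum.inr i)) g -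
      pderiv (Sum.inr (Sum.inr i)) f * pderiv (Sum.inr (Sum.inl i)) g)

/-- The action of `{Fᵢ, ·}` on `ℂ[q,p]`, where `Sum.inl i` is `qᵢ` and `Sum.inr i` is `pᵢ`. -/
noncomputable def weightDerivation {n : ℕ} (i : Fin n) :
    Derivation ℂ (MvPolynomial (Fin n ⊕ Fin n) ℂ) (MvPolynomial (Fin n ⊕ Fin n) ℂ) :=
  (X (Sum.inr i) : MvPolynomial (Fin n ⊕ Fin n) ℂ) • pderiv (Sum.inr i) -
    (X (Sum.inl i) : MvPolynomial (Fin n ⊕ Fin n) ℂ) • pderiv (Sum.inl i)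

theorem coeff_weightDerivation {n : ℕ} (i : Fin n) (f : MvPolynomial (Fin n ⊕ Fin n) ℂ)
    (m : Fin n ⊕ Fin n →₀ ℕ) :
    coeff m (weightDerivation i f) =
      ((m (Sum.inr i) : ℂ) - (m (Sum.inl i) : ℂ)) * coeff m f := by
  induction f using MvPolynomial.induction_on' with
  | monomial u a =>
    simp only [weightDerivation, Derivation.sub_apply, Derivation.smul_apply, smul_eq_mul,
      X_mul_pderiv_monomial, coeff_sub, coeff_smul, coeff_monomial]
    split_ifs with h
    · subst h
      simp only [nsmul_eq_mul]
      ring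
    · simp
  | add p q hp hq => rw [map_add, coeff_add, coeff_add, hp, hq]; ring

/-- The evaluation `λᵢ ↦ -qᵢpᵢ`, which identifies `ℂ[λ,q,p]/J` with `ℂ[q,p]`. -/
noncomputable def evalParams (n : ℕ) :
    MvPolynomial (Fin n ⊕ (Fin n ⊕ Fin n)) ℂ →ₐ[ℂ] MvPolynomial (Fin n ⊕ Fin n) ℂ :=
  aeval (Sum.elim (fun i => -(X (Sum.inl i) * X (Sum.inr i))) X)

theorem evalParams_rename_inr {n : ℕ} (f : MvPolynomial (Fin n ⊕ Fin n) ℂ) :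
    evalParams n (rename Sum.inr f) = f := by
  rw [evalParams, aeval_rename, Sum.elim_comp_inr, aeval_X_left_apply]

theorem mem_span_iff_evalParams_eq_zero {n : ℕ}
    (f : MvPolynomial (Fin n ⊕ (Fin n ⊕ Fin n)) ℂ) :
    f ∈ Ideal.span (Set.range fun i : Fin n =>
        (X (Sum.inr (Sum.inl i)) * X (Sum.inr (Sum.inr i)) + X (Sum.inl i) :
          MvPolynomial (Fin n ⊕ (Fin n ⊕ Fin n)) ℂ)) ↔ evalParams n f = 0 := by
  set J := Ideal.span (Set.range fun i : Fin n =>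
    (X (Sum.inr (Sum.inl i)) * X (Sum.inr (Sum.inr i)) + X (Sum.inl i) :
      MvPolynomial (Fin n ⊕ (Fin n ⊕ Fin n)) ℂ)) with hJ
  constructor
  · intro hf
    have hle : J ≤ RingHom.ker (evalParams n) := by
      rw [hJ, Ideal.span_le]
      rintro _ ⟨i, rfl⟩
      simp [evalParams, RingHom.mem_ker]
    exact hle hf
  · intro hf
    have hmk : (Ideal.Quotient.mkₐ ℂ J).comp ((rename Sum.inr).comp (evalParams n)) =
        Ideal.Quotient.mkₐ ℂ J := by
      ext j
      rcases j with i | j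
      · simp only [AlgHom.comp_apply, Ideal.Quotient.mkₐ_eq_mk]
        rw [eq_comm, Ideal.Quotient.eq]
        have : (X (Sum.inr (Sum.inl i)) * X (Sum.inr (Sum.inr i)) + X (Sum.inl i) :
            MvPolynomial (Fin n ⊕ (Fin n ⊕ Fin n)) ℂ) ∈ J := Ideal.subset_span ⟨i, rfl⟩
        convert this using 1
        simp [evalParams]
        ring
      · simp [evalParams]
    have := DFunLike.congr_fun hmk f
    simp only [AlgHom.comp_apply, hf, map_zero, Ideal.Quotient.mkₐ_eq_mk] at this
    exact Ideal.Quotient.eq_zero_iff_mem.mp this.symm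

theorem relPoissonBracket_quadric {n : ℕ} (i : Fin n)
    (f : MvPolynomial (Fin n ⊕ (Fin n ⊕ Fin n)) ℂ) :
    relPoissonBracket n
        (X (Sum.inr (Sum.inl i)) * X (Sum.inr (Sum.inr i)) + X (Sum.inl i)) f =
      X (Sum.inr (Sum.inr i)) * pderiv (Sum.inr (Sum.inr i)) f -
        X (Sum.inr (Sum.inl i)) * pderiv (Sum.inr (Sum.inl i)) f := by
  classical
  rw [relPoissonBracket, Finset.sum_eq_single i]
  · simp [pderiv_X]
  · intro j _ hj
    simp [pderiv_X, hj.symm]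
  · simp

theorem evalParams_relPoissonBracket {n : ℕ} (i : Fin n)
    (f : MvPolynomial (Fin n ⊕ (Fin n ⊕ Fin n)) ℂ) :
    evalParams n (relPoissonBracket n
        (X (Sum.inr (Sum.inl i)) * X (Sum.inr (Sum.inr i)) + X (Sum.inl i)) f) =
      weightDerivation i (evalParams n f) := by
  classical
  rw [relPoissonBracket_quadric]
  induction f using MvPolynomial.induction_on with
  | C a => simp [evalParams]
  | add p q hp hq =>
    simp only [map_add, map_sub, map_mul] at hp hq ⊢
    rw [← hp, ← hq]
    ring
  | mul_X p j hp =>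
    simp only [map_sub, map_mul, Derivation.leibniz, smul_eq_mul, map_add] at hp ⊢
    rw [← hp]
    rcases j with j | j | j <;> by_cases h : j = i
    all_goals
      try subst h
      simp [evalParams, weightDerivation, pderiv_X, *]
      ring

theorem weightDerivation_evalParams_rename_inl {n : ℕ} (i : Fin n)
    (b : MvPolynomial (Fin n) ℂ) :
    weightDerivation i (evalParams n (rename Sum.inl b)) = 0 := by
  classical
  rw [← evalParams_relPoissonBracket, relPoissonBracket_quadric]
  have hd (j : Fin n ⊕ Fin n) : pderiv (Sum.inr j)
      (rename (Sum.inl : Fin n → Fin n ⊕ (Fin n ⊕ Fin n)) b) = 0 := by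
    refine pderiv_eq_zero_of_notMem_vars fun hj => ?_
    simpa using vars_rename _ _ hj
  simp [hd]

theorem evalParams_rename_inl_injective (n : ℕ) :
    Function.Injective fun b : MvPolynomial (Fin n) ℂ =>
      evalParams n (rename Sum.inl b) := by
  refine Function.LeftInverse.injective
    (g := aeval (Sum.elim (fun i => -(X i : MvPolynomial (Fin n) ℂ)) fun _ => 1)) fun b => ?_
  have : ((aeval (Sum.elim (fun i => -(X i : MvPolynomial (Fin n) ℂ)) fun _ => 1)).comp
      ((evalParams n).comp (rename Sum.inl))) = AlgHom.id ℂ (MvPolynomial (Fin n) ℂ) := by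
    ext j
    simp [evalParams]
  exact DFunLike.congr_fun this b

theorem exists_evalParams_rename_inl_eq {n : ℕ} (f : MvPolynomial (Fin n ⊕ Fin n) ℂ)
    (hf : ∀ m ∈ f.support, ∀ i, m (Sum.inr i) = m (Sum.inl i)) :
    ∃ b : MvPolynomial (Fin n) ℂ, evalParams n (rename Sum.inl b) = f := by
  suffices f ∈ ((evalParams n).comp (rename Sum.inl)).range from this
  rw [f.as_sum]
  refine Subalgebra.sum_mem _ fun m hm => ⟨C (coeff m f) * ∏ i, (-X i) ^ m (Sum.inl i), ?_⟩
  rw [monomial_eq, Finsupp.prod_fintype _ _ (by simp), Fintype.prod_sum_type,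
    ← Finset.prod_mul_distrib]
  simp [evalParams, hf m hm, mul_pow]

/-- The joint-eigenspace form of the Poincaré lemma for the commuting weight derivations. -/
theorem exists_support_sub_weightDerivation {n : ℕ}
    (γ : Fin n → MvPolynomial (Fin n ⊕ Fin n) ℂ)
    (hγ : ∀ i j, weightDerivation i (γ j) = weightDerivation j (γ i)) :
    ∃ h : MvPolynomial (Fin n ⊕ Fin n) ℂ, ∀ j,
      ∀ m ∈ (γ j - weightDerivation j h).support, ∀ i, m (Sum.inr i) = m (Sum.inl i) := by
  classical
  have hc (i j : Fin n) (m : Fin n ⊕ Fin n →₀ ℕ) :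
      ((m (Sum.inr i) : ℂ) - (m (Sum.inl i) : ℂ)) * coeff m (γ j) =
        ((m (Sum.inr j) : ℂ) - (m (Sum.inl j) : ℂ)) * coeff m (γ i) := by
    rw [← coeff_weightDerivation, ← coeff_weightDerivation, hγ]
  have hex (m : Fin n ⊕ Fin n →₀ ℕ) : ∃ c : ℂ,
      ((∃ i, m (Sum.inr i) ≠ m (Sum.inl i)) → ∀ j,
        coeff m (γ j) = ((m (Sum.inr j) : ℂ) - (m (Sum.inl j) : ℂ)) * c) := by
    by_cases hm : ∃ i, m (Sum.inr i) ≠ m (Sum.inl i)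
    · obtain ⟨i, hi⟩ := hm
      have hi' : (m (Sum.inr i) : ℂ) - (m (Sum.inl i) : ℂ) ≠ 0 :=
        sub_ne_zero.mpr (by exact_mod_cast hi)
      refine ⟨coeff m (γ i) / ((m (Sum.inr i) : ℂ) - (m (Sum.inl i) : ℂ)), fun _ j => ?_⟩
      rw [mul_div_assoc', eq_div_iff hi', mul_comm, hc]
    · exact ⟨0, fun h => absurd h hm⟩
  choose c hcm using hex
  refine ⟨∑ m ∈ Finset.univ.biUnion fun i => (γ i).support, monomial m (c m),
    fun j m hm => ?_⟩
  by_contra! hne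
  refine mem_support_iff.mp hm ?_
  rw [coeff_sub, coeff_weightDerivation, coeff_sum]
  simp only [coeff_monomial, Finset.sum_ite_eq']
  split_ifs with hmem
  · rw [hcm m hne j, sub_self]
  · have : coeff m (γ j) = 0 := by
      by_contra h0
      exact hmem (Finset.mem_biUnion.mpr ⟨j, Finset.mem_univ j, mem_support_iff.mpr h0⟩)
    rw [this, mul_zero, sub_zero]

theorem eq_zero_of_weightDerivation_eq {n : ℕ} (i : Fin n)
    (f h : MvPolynomial (Fin n ⊕ Fin n) ℂ) (hf : weightDerivation i f = 0)
    (hfh : f = weightDerivation i h) : f = 0 := by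
  ext m
  have h0 := congrArg (coeff m) hf
  have h1 := congrArg (coeff m) hfh
  rw [coeff_weightDerivation, coeff_zero, mul_eq_zero] at h0
  rw [coeff_weightDerivation] at h1
  rcases h0 with h0 | h0
  · rw [h1, h0, zero_mul, coeff_zero]
  · rw [h0, coeff_zero]

/-- `H¹` of the relative Lagrange complex of the deformation `Fᵢ = qᵢpᵢ + λᵢ`
is a free module of rank `n` over the parameter ring: every relative cocycle
`(g₁,…,gₙ)` equals, modulo `J = (F₁,…,Fₙ)` and modulo a coboundary
`({Fᵢ,h})ᵢ`, a uniquely determined tuple `(b₁,…,bₙ)` of polynomials in the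
parameters `λ` only. -/
theorem stmt_8 (n : ℕ) (hn : 1 ≤ n)
    (F : Fin n → MvPolynomial (Fin n ⊕ (Fin n ⊕ Fin n)) ℂ)
    (hF : ∀ i : Fin n,
      F i = X (Sum.inr (Sum.inl i)) * X (Sum.inr (Sum.inr i)) + X (Sum.inl i))
    (J : Ideal (MvPolynomial (Fin n ⊕ (Fin n ⊕ Fin n)) ℂ))
    (hJ : J = Ideal.span (Set.range F))
    (g : Fin n → MvPolynomial (Fin n ⊕ (Fin n ⊕ Fin n)) ℂ)
    (hcoc : ∀ i j : Fin n,
      relPoissonBracket n (F i) (g j) - relPoissonBracket n (F j) (g i) ∈ J) :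
    ∃! b : Fin n → MvPolynomial (Fin n) ℂ,
      ∃ h : MvPolynomial (Fin n ⊕ (Fin n ⊕ Fin n)) ℂ,
        ∀ i : Fin n,
          g i - rename (Sum.inl : Fin n → Fin n ⊕ (Fin n ⊕ Fin n)) (b i)
            - relPoissonBracket n (F i) h ∈ J := by
  obtain rfl : F = _ := funext hF
  subst hJ
  simp only [mem_span_iff_evalParams_eq_zero, map_sub, evalParams_relPoissonBracket,
    sub_eq_zero] at hcoc ⊢
  obtain ⟨h, hh⟩ := exists_support_sub_weightDerivation (fun i => evalParams n (g i)) hcoc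
  choose b hb using fun j => exists_evalParams_rename_inl_eq _ (hh j)
  refine ⟨b, ⟨rename Sum.inr h, fun i => ?_⟩, ?_⟩
  · rw [hb, evalParams_rename_inr, sub_sub_cancel]
  · rintro b' ⟨h', hh'⟩
    funext i
    apply evalParams_rename_inl_injective n
    dsimp only
    rw [← sub_eq_zero]
    refine eq_zero_of_weightDerivation_eq i _ (h - evalParams n h') ?_ ?_
    · simp only [map_sub, weightDerivation_evalParams_rename_inl, sub_self]
    · rw [hb, map_sub, ← hh' i]
      ring
end
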